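/- arXiv:2605.02040 — 2 statements merged into one kernel-verified Lean document; each statement's English description precedes it below -/
import Mathlib

section
/- Fix T > 0 and x, k ∈ ℝ. The map σ ↦ Bac(T,x,k,σ) is continuous and strictly increasing on (0,∞), tends to max(x − k, 0) as σ → 0⁺ and to +∞ as σ → ∞; consequently, for every price V with max(x − k, 0) < V there exists a unique σ > 0 (the Bachelier implied volatility) with Bac(T,x,k,σ) = V. -/
open MeasureTheory ProbabilityTheory Real NNReal

/-- Standard normal cumulative distribution function. -/
noncomputable def normalCDF (z : ℝ) : ℝ :=
  ∫ t in Set.Iic z, Real.exp (-t ^ 2 / 2) / Real.sqrt (2 * Real.pi)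

/-- Standard normal probability density function. -/
noncomputable def normalPDF (z : ℝ) : ℝ :=
  Real.exp (-z ^ 2 / 2) / Real.sqrt (2 * Real.pi)

/-- Bachelier moneyness. -/
noncomputable def dBac (T x k σ : ℝ) : ℝ := (x - k) / (σ * Real.sqrt T)

/-- Bachelier call price. -/
noncomputable def Bac (T x k σ : ℝ) : ℝ :=
  (x - k) * normalCDF (dBac T x k σ) + σ * Real.sqrt T * normalPDF (dBac T x k σ)

theorem normalPDF_eq_gaussianPDFReal (z : ℝ) : normalPDF z = gaussianPDFReal 0 1 z := by
  simp [normalPDF, gaussianPDFReal, div_eq_inv_mul]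

theorem normalCDF_eq_setIntegral_normalPDF (z : ℝ) :
    normalCDF z = ∫ t in Set.Iic z, normalPDF t := rfl

theorem integrable_normalPDF : Integrable normalPDF :=
  (integrable_gaussianPDFReal 0 1).congr (.of_forall fun z => (normalPDF_eq_gaussianPDFReal z).symm)

theorem integral_normalPDF : ∫ z, normalPDF z = 1 := by
  simp_rw [normalPDF_eq_gaussianPDFReal]
  exact integral_gaussianPDFReal_eq_one 0 one_ne_zero

theorem normalPDF_pos (z : ℝ) : 0 < normalPDF z := by
  unfold normalPDF
  positivity

theorem normalPDF_le_normalPDF_zero (z : ℝ) : normalPDF z ≤ normalPDF 0 := by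
  unfold normalPDF
  have h : -z ^ 2 / 2 ≤ -(0 : ℝ) ^ 2 / 2 := by nlinarith [sq_nonneg z]
  exact div_le_div_of_nonneg_right (exp_le_exp.2 h) (sqrt_nonneg _)

theorem hasDerivAt_normalPDF (z : ℝ) : HasDerivAt normalPDF (-z * normalPDF z) z := by
  have h : HasDerivAt normalPDF
      (rexp (-z ^ 2 / 2) * (-(2 * z) / 2) / √(2 * π)) z := by
    have hp : HasDerivAt (fun y : ℝ => y ^ 2) (2 * z) z := by simpa using hasDerivAt_pow 2 z
    exact ((hp.fun_neg.div_const 2).exp).div_const √(2 * π)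
  convert h using 1
  unfold normalPDF
  ring

theorem continuous_normalPDF : Continuous normalPDF :=
  continuous_iff_continuousAt.2 fun z => (hasDerivAt_normalPDF z).continuousAt

theorem hasDerivAt_normalCDF (z : ℝ) : HasDerivAt normalCDF (normalPDF z) z := by
  have h : normalCDF = fun y => normalCDF 0 + ∫ t in (0 : ℝ)..y, normalPDF t := by
    funext y
    rw [← intervalIntegral.integral_Iic_sub_Iic integrable_normalPDF.integrableOn
      integrable_normalPDF.integrableOn]
    simp [normalCDF_eq_setIntegral_normalPDF]
  rw [h]
  exact (continuous_normalPDF.integral_hasStrictDerivAt 0 z).hasDerivAt.const_add _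

theorem tendsto_normalCDF_atTop : Filter.Tendsto normalCDF Filter.atTop (nhds 1) := by
  rw [← integral_normalPDF]
  exact (aecover_Iic Filter.tendsto_id).integral_tendsto_of_countably_generated
    integrable_normalPDF

theorem tendsto_normalCDF_atBot : Filter.Tendsto normalCDF Filter.atBot (nhds 0) := by
  have h (z : ℝ) : 1 - ∫ t in Set.Ioi z, normalPDF t = normalCDF z := by
    rw [← integral_normalPDF, ← intervalIntegral.integral_Iic_add_Ioi
      (integrable_normalPDF.integrableOn (s := Set.Iic z)) integrable_normalPDF.integrableOn,
      normalCDF_eq_setIntegral_normalPDF]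
    ring
  have h' := ((aecover_Ioi (μ := volume)
    Filter.tendsto_id).integral_tendsto_of_countably_generated integrable_normalPDF).const_sub 1
  rw [integral_normalPDF, sub_self] at h'
  exact h'.congr h

/-- The Bachelier vega is `√T * φ(d)`. -/
theorem hasDerivAt_Bac {T σ : ℝ} (x k : ℝ) (hT : 0 < T) (hσ : 0 < σ) :
    HasDerivAt (Bac T x k) (√T * normalPDF (dBac T x k σ)) σ := by
  have hs : 0 < √T := sqrt_pos.2 hT
  have hm : HasDerivAt (fun σ => σ * √T) (√T) σ := by
    simpa using (hasDerivAt_id σ).mul_const √T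
  have hd : HasDerivAt (dBac T x k) (-((x - k) * √T) / (σ * √T) ^ 2) σ := by
    have h := (hasDerivAt_const σ (x - k)).fun_div hm (by positivity)
    rwa [zero_mul, zero_sub] at h
  have hN := ((hasDerivAt_normalCDF (dBac T x k σ)).comp σ hd).const_mul (x - k)
  have hφ := hm.mul ((hasDerivAt_normalPDF (dBac T x k σ)).comp σ hd)
  refine (hN.add hφ).congr_deriv ?_
  have hx : x - k = dBac T x k σ * (σ * √T) := by
    unfold dBac
    field_simp
  rw [Function.comp_apply]
  generalize dBac T x k σ = d at hx ⊢
  rw [hx]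
  field_simp
  ring

theorem continuousOn_Bac {T : ℝ} (x k : ℝ) (hT : 0 < T) :
    ContinuousOn (Bac T x k) (Set.Ioi 0) :=
  fun _ hσ => (hasDerivAt_Bac x k hT hσ).continuousAt.continuousWithinAt

theorem strictMonoOn_Bac {T : ℝ} (x k : ℝ) (hT : 0 < T) :
    StrictMonoOn (Bac T x k) (Set.Ioi 0) := by
  refine strictMonoOn_of_deriv_pos (convex_Ioi 0) (continuousOn_Bac x k hT) fun σ hσ => ?_
  rw [interior_Ioi] at hσ
  rw [(hasDerivAt_Bac x k hT hσ).deriv]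
  exact mul_pos (sqrt_pos.2 hT) (normalPDF_pos _)

theorem tendsto_mul_normalCDF_dBac_nhdsGT_zero {T : ℝ} (x k : ℝ) (hT : 0 < T) :
    Filter.Tendsto (fun σ => (x - k) * normalCDF (dBac T x k σ)) (nhdsWithin 0 (Set.Ioi 0))
      (nhds (max (x - k) 0)) := by
  have hinv : Filter.Tendsto (fun σ : ℝ => (σ * √T)⁻¹) (nhdsWithin 0 (Set.Ioi 0))
      Filter.atTop := by
    simp_rw [mul_inv]
    exact tendsto_inv_nhdsGT_zero.atTop_mul_const (inv_pos.2 (sqrt_pos.2 hT))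
  rcases lt_trichotomy (x - k) 0 with h | h | h
  · have hd : Filter.Tendsto (dBac T x k) (nhdsWithin 0 (Set.Ioi 0)) Filter.atBot :=
      hinv.const_mul_atTop_of_neg h
    simpa [max_eq_right h.le] using (tendsto_normalCDF_atBot.comp hd).const_mul (x - k)
  · simp [h]
  · have hd : Filter.Tendsto (dBac T x k) (nhdsWithin 0 (Set.Ioi 0)) Filter.atTop :=
      hinv.const_mul_atTop h
    simpa [max_eq_left h.le] using (tendsto_normalCDF_atTop.comp hd).const_mul (x - k)

theorem tendsto_Bac_nhdsGT_zero {T : ℝ} (x k : ℝ) (hT : 0 < T) :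
    Filter.Tendsto (Bac T x k) (nhdsWithin 0 (Set.Ioi 0)) (nhds (max (x - k) 0)) := by
  have hlim : Filter.Tendsto (fun σ : ℝ => σ * √T) (nhdsWithin 0 (Set.Ioi 0)) (nhds 0) := by
    have h : Continuous fun σ : ℝ => σ * √T := by fun_prop
    simpa using (h.tendsto 0).mono_left nhdsWithin_le_nhds
  have hbdd : Filter.IsBoundedUnder (· ≤ ·) (nhdsWithin 0 (Set.Ioi 0))
      (norm ∘ fun σ => normalPDF (dBac T x k σ)) :=
    Filter.isBoundedUnder_of ⟨normalPDF 0, fun σ => by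
      simpa [abs_of_pos (normalPDF_pos _)] using normalPDF_le_normalPDF_zero (dBac T x k σ)⟩
  have h := (tendsto_mul_normalCDF_dBac_nhdsGT_zero x k hT).add
    (hlim.zero_mul_isBoundedUnder_le hbdd)
  rwa [add_zero] at h

theorem tendsto_Bac_atTop {T : ℝ} (x k : ℝ) (hT : 0 < T) :
    Filter.Tendsto (Bac T x k) Filter.atTop Filter.atTop := by
  have hm : Filter.Tendsto (fun σ : ℝ => σ * √T) Filter.atTop Filter.atTop :=
    Filter.tendsto_id.atTop_mul_const (sqrt_pos.2 hT)
  have hd : Filter.Tendsto (dBac T x k) Filter.atTop (nhds 0) := hm.const_div_atTop (x - k)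
  have hN := (((hasDerivAt_normalCDF 0).continuousAt.tendsto.comp hd).const_mul (x - k))
  exact hN.add_atTop
    (hm.atTop_mul_pos (normalPDF_pos 0) ((continuous_normalPDF.tendsto 0).comp hd))

/-- The map `σ ↦ Bac(T,x,k,σ)` is continuous and strictly increasing on `(0,∞)`,
tends to `max (x−k) 0` as `σ → 0⁺`, tends to `+∞` as `σ → ∞`, and therefore every
price `V > max (x−k) 0` is attained at a unique volatility `σ > 0`
(the Bachelier implied volatility). -/
theorem bachelier_implied_volatility_exists_unique (T x k : ℝ) (hT : 0 < T) :
    ContinuousOn (fun σ => Bac T x k σ) (Set.Ioi 0) ∧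
    StrictMonoOn (fun σ => Bac T x k σ) (Set.Ioi 0) ∧
    Filter.Tendsto (fun σ => Bac T x k σ) (nhdsWithin 0 (Set.Ioi 0))
      (nhds (max (x - k) 0)) ∧
    Filter.Tendsto (fun σ => Bac T x k σ) Filter.atTop Filter.atTop ∧
    ∀ V : ℝ, max (x - k) 0 < V → ∃! σ : ℝ, 0 < σ ∧ Bac T x k σ = V := by
  refine ⟨continuousOn_Bac x k hT, strictMonoOn_Bac x k hT, tendsto_Bac_nhdsGT_zero x k hT,
    tendsto_Bac_atTop x k hT, fun V hV => ?_⟩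
  obtain ⟨a, haV, ha⟩ := (((tendsto_Bac_nhdsGT_zero x k hT).eventually_lt_const hV).and
    self_mem_nhdsWithin).exists
  obtain ⟨b, hbV, hab⟩ := (((tendsto_Bac_atTop x k hT).eventually_ge_atTop V).and
    (Filter.eventually_ge_atTop a)).exists
  obtain ⟨σ, hσ, hσV⟩ := intermediate_value_Icc hab
    ((continuousOn_Bac x k hT).mono fun y hy => lt_of_lt_of_le ha hy.1) ⟨haV.le, hbV⟩
  have hσ0 : 0 < σ := lt_of_lt_of_le ha hσ.1
  exact ⟨σ, ⟨hσ0, hσV⟩, fun τ hτ =>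
    (strictMonoOn_Bac x k hT).injOn hτ.1 hσ0 (hτ.2.trans hσV.symm)⟩
end

section
/- (Price expansion, Theorem 3.1, stated in mixed form.) Let T > 0, x, k ∈ ℝ and set a = (x − k)²/(2T). Let W be a random variable with W > 0 almost surely, E[W] < ∞ and E[W^{1/2}·exp(a/W)] < ∞. Then E[Bac(T, x, k, √W)] = Bac(T, x, k, √(E[W])) + (√T/√(2π))·(E[√W] − √(E[W])) − (√T/√(2π)) · Σ_{n=1}^∞ [1/(n!·(2n−1))] · (−a)ⁿ · ( E[W^{1/2−n}] − (E[W])^{1/2−n} ), the series converging absolutely. -/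
open MeasureTheory ProbabilityTheory Real NNReal

theorem integrable_exp_neg_sq_div_two : Integrable fun t : ℝ => Real.exp (-t ^ 2 / 2) := by
  refine (integrable_exp_neg_mul_sq (b := 1 / 2) (by norm_num)).congr (ae_of_all _ fun t => ?_)
  dsimp only
  congr 1
  ring

theorem integral_Iic_exp_neg_sq_div_two :
    ∫ t in Set.Iic (0 : ℝ), Real.exp (-t ^ 2 / 2) = Real.sqrt (2 * Real.pi) / 2 := by
  have h := integral_comp_neg_Iic (0 : ℝ) fun t : ℝ => Real.exp (-(1 / 2) * t ^ 2)
  rw [neg_zero, integral_gaussian_Ioi] at h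
  rw [show 2 * Real.pi = Real.pi / (1 / 2) by ring, ← h]
  congr 1 with t
  congr 1
  ring

theorem normalCDF_eq_intervalIntegral (z : ℝ) :
    normalCDF z = 1 / 2 + (∫ t in (0 : ℝ)..z, Real.exp (-t ^ 2 / 2)) / Real.sqrt (2 * Real.pi) := by
  have h := intervalIntegral.integral_Iic_sub_Iic (a := 0) (b := z)
    integrable_exp_neg_sq_div_two.integrableOn integrable_exp_neg_sq_div_two.integrableOn
  have hs : Real.sqrt (2 * Real.pi) ≠ 0 := by positivity
  rw [normalCDF, integral_div, ← h, integral_Iic_exp_neg_sq_div_two]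
  field_simp
  ring

theorem hasSum_intervalIntegral_exp_neg_sq_div_two (z : ℝ) :
    HasSum (fun n : ℕ => (-1 / 2) ^ n / (n.factorial : ℝ) * (z ^ (2 * n + 1) / (2 * n + 1)))
      (∫ t in (0 : ℝ)..z, Real.exp (-t ^ 2 / 2)) := by
  have h := intervalIntegral.hasSum_integral_of_dominated_convergence (a := 0) (b := z)
    (μ := volume) (F := fun (n : ℕ) (t : ℝ) => (-t ^ 2 / 2) ^ n / (n.factorial : ℝ))
    (f := fun t => Real.exp (-t ^ 2 / 2))
    (fun n _ => (z ^ 2 / 2) ^ n / (n.factorial : ℝ))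
    (fun n => (by fun_prop : Continuous fun t : ℝ =>
      (-t ^ 2 / 2) ^ n / (n.factorial : ℝ)).aestronglyMeasurable)
    (fun n => ae_of_all _ fun t ht => by
      have h1 : t ^ 2 ≤ z ^ 2 := by
        rcases Set.mem_uIoc.1 ht with h | h <;> nlinarith
      rw [norm_div, norm_pow, Real.norm_eq_abs, RCLike.norm_natCast, neg_div, abs_neg,
        abs_of_nonneg (by positivity)]
      gcongr)
    (ae_of_all _ fun t _ => Real.summable_pow_div_factorial _)
    intervalIntegrable_const
    (ae_of_all _ fun t _ => by
      rw [Real.exp_eq_exp_ℝ]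
      exact NormedSpace.expSeries_div_hasSum_exp _)
  convert! h using 2 with n
  have e : ∀ t : ℝ, (-t ^ 2 / 2) ^ n / (n.factorial : ℝ)
      = (-1 / 2) ^ n / (n.factorial : ℝ) * t ^ (2 * n) := fun t => by
    rw [show -t ^ 2 / 2 = (-1 / 2) * t ^ 2 by ring, mul_pow, pow_mul]
    ring
  simp_rw [e]
  rw [intervalIntegral.integral_const_mul, integral_pow]
  simp

theorem rpow_half_sub_natCast_succ {w : ℝ} (hw : 0 < w) (n : ℕ) :
    w ^ ((1 : ℝ) / 2 - ((n : ℝ) + 1)) = w ^ ((1 : ℝ) / 2) * (w⁻¹) ^ (n + 1) := by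
  rw [Real.rpow_sub hw, ← Nat.cast_succ, Real.rpow_natCast, inv_pow, div_eq_mul_inv]

/-- The Bachelier price at normal volatility `√w` as a series in powers of `1 / w`. -/
theorem hasSum_Bac_sqrt {T w : ℝ} (x k : ℝ) (hT : 0 < T) (hw : 0 < w) :
    HasSum (fun n : ℕ => 1 / ((Nat.factorial (n + 1) : ℝ) * (2 * ((n : ℝ) + 1) - 1)) *
        (-((x - k) ^ 2 / (2 * T))) ^ (n + 1) * w ^ ((1 : ℝ) / 2 - ((n : ℝ) + 1)))
      (Real.sqrt w - (Bac T x k (Real.sqrt w) - (x - k) / 2) /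
        (Real.sqrt T / Real.sqrt (2 * Real.pi))) := by
  have hs : 0 < Real.sqrt w := Real.sqrt_pos.2 hw
  have hq : 0 < Real.sqrt T := Real.sqrt_pos.2 hT
  have hp : Real.sqrt (2 * Real.pi) ≠ 0 := by positivity
  obtain ⟨d, hd⟩ : ∃ d, d = dBac T x k (Real.sqrt w) := ⟨_, rfl⟩
  have hxk : x - k = d * (Real.sqrt w * Real.sqrt T) := by
    rw [hd, dBac]
    field_simp
  have hu : -((x - k) ^ 2 / (2 * T)) = -d ^ 2 / 2 * w := by
    rw [hxk, mul_pow, mul_pow, Real.sq_sqrt hw.le, Real.sq_sqrt hT.le]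
    field_simp
  have h1 : HasSum (fun n : ℕ => (-d ^ 2 / 2) ^ n / (n.factorial : ℝ))
      (Real.exp (-d ^ 2 / 2)) := by
    rw [Real.exp_eq_exp_ℝ]
    exact NormedSpace.expSeries_div_hasSum_exp _
  have h := (((hasSum_nat_add_iff' 1).2 h1).neg.sub
    ((hasSum_intervalIntegral_exp_neg_sq_div_two d).mul_left d)).mul_left (Real.sqrt w)
  convert! h using 1
  · ext n
    rw [hu, rpow_half_sub_natCast_succ hw, ← Real.sqrt_eq_rpow, mul_pow _ w, Nat.factorial_succ,
      inv_pow, show -d ^ 2 / 2 = (-1 / 2) * d ^ 2 by ring, mul_pow, ← pow_mul]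
    have h2 : 2 * (n : ℝ) + 1 ≠ 0 := by positivity
    rw [show 2 * ((n : ℝ) + 1) - 1 = 2 * n + 1 by ring]
    push_cast
    field_simp
    ring
  · rw [Bac, ← hd, normalCDF_eq_intervalIntegral, normalPDF, hxk]
    simp only [Finset.sum_range_one, pow_zero, Nat.factorial_zero, Nat.cast_one]
    field_simp
    ring

theorem hasSum_pow_succ_div_factorial_mul_rpow (a : ℝ) {w : ℝ} (hw : 0 < w) :
    HasSum (fun n : ℕ => a ^ (n + 1) / (Nat.factorial (n + 1) : ℝ) *
        w ^ ((1 : ℝ) / 2 - ((n : ℝ) + 1)))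
      (w ^ ((1 : ℝ) / 2) * Real.exp (a / w) - w ^ ((1 : ℝ) / 2)) := by
  have h1 : HasSum (fun n : ℕ => (a / w) ^ n / (n.factorial : ℝ)) (Real.exp (a / w)) := by
    rw [Real.exp_eq_exp_ℝ]
    exact NormedSpace.expSeries_div_hasSum_exp _
  convert! ((hasSum_nat_add_iff' 1).2 h1).mul_left (w ^ ((1 : ℝ) / 2)) using 1
  · ext n
    rw [rpow_half_sub_natCast_succ hw, div_eq_mul_inv a w, mul_pow]
    ring
  · simp [mul_sub]

theorem norm_price_term_le {a w : ℝ} (ha : 0 ≤ a) (hw : 0 < w) (n : ℕ) :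
    ‖1 / ((Nat.factorial (n + 1) : ℝ) * (2 * ((n : ℝ) + 1) - 1)) * (-a) ^ (n + 1) *
        w ^ ((1 : ℝ) / 2 - ((n : ℝ) + 1))‖
      ≤ a ^ (n + 1) / (Nat.factorial (n + 1) : ℝ) * w ^ ((1 : ℝ) / 2 - ((n : ℝ) + 1)) := by
  have h3 : 1 ≤ 2 * ((n : ℝ) + 1) - 1 := by
    linarith [(Nat.cast_nonneg n : (0 : ℝ) ≤ n)]
  have hf : (0 : ℝ) < Nat.factorial (n + 1) := by positivity
  rw [norm_mul, norm_mul, norm_pow, norm_neg, Real.norm_of_nonneg (Real.rpow_nonneg hw.le _),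
    Real.norm_of_nonneg ha, Real.norm_of_nonneg (by positivity), div_eq_mul_one_div (a ^ _),
    mul_comm (a ^ _)]
  gcongr
  exact le_mul_of_one_le_right hf.le h3

theorem integrable_and_hasSum_integral_of_norm_le {α : Type*} [MeasurableSpace α] {μ : Measure α}
    {F bound : ℕ → α → ℝ} {f g : α → ℝ} (hF : ∀ n, AEStronglyMeasurable (F n) μ)
    (hle : ∀ n, ∀ᵐ a ∂μ, ‖F n a‖ ≤ bound n a) (hg : Integrable g μ)
    (hbound : ∀ᵐ a ∂μ, HasSum (fun n => bound n a) (g a))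
    (hf : ∀ᵐ a ∂μ, HasSum (fun n => F n a) (f a)) :
    Integrable f μ ∧ HasSum (fun n => ∫ a, F n a ∂μ) (∫ a, f a ∂μ) := by
  refine ⟨hg.mono' (aestronglyMeasurable_of_tendsto_ae Filter.atTop
    (fun n => Finset.aestronglyMeasurable_fun_sum (Finset.range n) fun i _ => hF i) ?_) ?_,
    hasSum_integral_of_dominated_convergence bound hF hle ?_ ?_ hf⟩
  · filter_upwards [hf] with a ha using ha.tendsto_sum_nat
  · filter_upwards [hf, hbound, ae_all_iff.2 hle] with a ha hb hl using ha.norm_le_of_bounded hb hl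
  · filter_upwards [hbound] with a ha using ha.summable
  · refine hg.congr ?_
    filter_upwards [hbound] with a ha using ha.tsum_eq.symm

/-- Price expansion (Theorem 3.1, mixed form). With `a = (x−k)²/(2T)` and `W`
the realized average variance,
`E[Bac(T,x,k,√W)] = Bac(T,x,k,√E[W]) + (√T/√(2π))(E[√W] − √E[W])
  − (√T/√(2π)) Σ_{n≥1} [1/(n!(2n−1))] (−a)ⁿ (E[W^{1/2−n}] − (E[W])^{1/2−n})`,
the series (indexed below by `n+1`) converging absolutely. -/
theorem bachelier_price_expansion_mixed
    {Ω : Type*} [MeasurableSpace Ω] (P : Measure Ω) [IsProbabilityMeasure P]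
    (T x k : ℝ) (hT : 0 < T)
    (W : Ω → ℝ) (hW : Measurable W) (hpos : ∀ᵐ ω ∂P, 0 < W ω)
    (hWint : Integrable W P)
    (hexp : Integrable
      (fun ω => W ω ^ ((1 : ℝ) / 2) * Real.exp ((x - k) ^ 2 / (2 * T) / W ω)) P) :
    (Summable fun n : ℕ =>
      |1 / ((Nat.factorial (n + 1) : ℝ) * (2 * ((n : ℝ) + 1) - 1)) *
        (-((x - k) ^ 2 / (2 * T))) ^ (n + 1) *
        ((∫ ω, W ω ^ ((1 : ℝ) / 2 - ((n : ℝ) + 1)) ∂P)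
          - (∫ ω, W ω ∂P) ^ ((1 : ℝ) / 2 - ((n : ℝ) + 1)))|) ∧
    ∫ ω, Bac T x k (Real.sqrt (W ω)) ∂P
      = Bac T x k (Real.sqrt (∫ ω, W ω ∂P))
        + Real.sqrt T / Real.sqrt (2 * Real.pi) *
            ((∫ ω, Real.sqrt (W ω) ∂P) - Real.sqrt (∫ ω, W ω ∂P))
        - Real.sqrt T / Real.sqrt (2 * Real.pi) *
          ∑' n : ℕ, 1 / ((Nat.factorial (n + 1) : ℝ) * (2 * ((n : ℝ) + 1) - 1)) *
            (-((x - k) ^ 2 / (2 * T))) ^ (n + 1) *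
            ((∫ ω, W ω ^ ((1 : ℝ) / 2 - ((n : ℝ) + 1)) ∂P)
              - (∫ ω, W ω ∂P) ^ ((1 : ℝ) / 2 - ((n : ℝ) + 1))) := by
  have hC : Real.sqrt T / Real.sqrt (2 * Real.pi) ≠ 0 := by positivity
  have ha : 0 ≤ (x - k) ^ 2 / (2 * T) := by positivity
  have hsqrt : Integrable (fun ω => Real.sqrt (W ω)) P := by
    refine hexp.mono' hW.sqrt.aestronglyMeasurable ?_
    filter_upwards [hpos] with ω hω
    rw [Real.norm_of_nonneg (Real.sqrt_nonneg _), Real.sqrt_eq_rpow]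
    exact le_mul_of_one_le_right (by positivity) (Real.one_le_exp (by positivity))
  have hEW : 0 < ∫ ω, W ω ∂P := by
    refine (integral_nonneg_of_ae (hpos.mono fun ω h => h.le)).lt_of_ne' fun h0 => ?_
    obtain ⟨ω, hω, h0ω⟩ := (hpos.and
      ((integral_eq_zero_iff_of_nonneg_ae (hpos.mono fun ω h => h.le) hWint).1 h0)).exists
    exact hω.ne' h0ω
  obtain ⟨hint, hsum⟩ := integrable_and_hasSum_integral_of_norm_le (μ := P)
    (F := fun (n : ℕ) ω => 1 / ((Nat.factorial (n + 1) : ℝ) * (2 * ((n : ℝ) + 1) - 1)) *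
      (-((x - k) ^ 2 / (2 * T))) ^ (n + 1) * W ω ^ ((1 : ℝ) / 2 - ((n : ℝ) + 1)))
    (fun n => ((hW.pow_const _).const_mul _).aestronglyMeasurable)
    (fun n => hpos.mono fun ω hω => norm_price_term_le ha hω n)
    (hexp.sub (hsqrt.congr (ae_of_all _ fun ω => Real.sqrt_eq_rpow (W ω))))
    (hpos.mono fun ω hω => hasSum_pow_succ_div_factorial_mul_rpow _ hω)
    (hpos.mono fun ω hω => hasSum_Bac_sqrt x k hT hω)
  have h := hsum.sub (hasSum_Bac_sqrt x k hT hEW)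
  simp only [integral_const_mul, ← mul_sub] at h
  refine ⟨h.summable.abs, ?_⟩
  have hBac : ∫ ω, Bac T x k (Real.sqrt (W ω)) ∂P = (x - k) / 2
      + Real.sqrt T / Real.sqrt (2 * Real.pi) * ((∫ ω, Real.sqrt (W ω) ∂P)
        - ∫ ω, (Real.sqrt (W ω) - (Bac T x k (Real.sqrt (W ω)) - (x - k) / 2) /
          (Real.sqrt T / Real.sqrt (2 * Real.pi))) ∂P) := by
    have hi : Integrable (fun ω => Real.sqrt T / Real.sqrt (2 * Real.pi) * (Real.sqrt (W ω)
        - (Real.sqrt (W ω) - (Bac T x k (Real.sqrt (W ω)) - (x - k) / 2) /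
          (Real.sqrt T / Real.sqrt (2 * Real.pi))))) P := (hsqrt.sub hint).const_mul _
    rw [← integral_sub hsqrt hint, ← integral_const_mul]
    convert! integral_add (integrable_const ((x - k) / 2)) hi using 2
    · ext ω
      field_simp
      ring
    · simp
  rw [h.tsum_eq, hBac]
  field_simp
  ring
end
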